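/- Let t ≥ 2 and let λ = (2^t − u, 1^u) for some u ∈ {0, 1, …, 2^t − 1} (every such hook partition of 2^t is odd). Then f_0(f_0(λ)) = f_1(λ) if and only if u ≡ 0 (mod 4) or u ≡ 3 (mod 4). In particular, G_0(2^t) = 2^{t−1}. -/

import Mathlib

namespace OddSym

open scoped Classical

/-- Remove one box from a row of size `p` (as multisets of parts). -/
def removeBox (lam : Multiset ℕ) (p : ℕ) : Multiset ℕ :=
  if p ≤ 1 then lam.erase p else (p - 1) ::ₘ lam.erase p

lemma removeBox_sum_lt {lam : Multiset ℕ} {p : ℕ} (hp : p ∈ lam) (h0 : 0 < p) :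
    (removeBox lam p).sum < lam.sum := by
  have h : p + (lam.erase p).sum = lam.sum := by
    conv_rhs => rw [← Multiset.cons_erase hp]
    simp [Multiset.sum_cons]
  unfold removeBox
  split
  · omega
  · simp only [Multiset.sum_cons]
    omega

/-- The number of standard Young tableaux of shape `lam`
(equivalently, the degree of the irreducible character of the symmetric
group labelled by `lam`), defined via the branching rule. -/
def degSYT (lam : Multiset ℕ) : ℕ :=
  if _h : lam = 0 then 1
  else ∑ p ∈ (lam.toFinset.filter (fun p => 0 < p)).attach, degSYT (removeBox lam p.1)
termination_by lam.sum
decreasing_by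
  have hp := p.2
  simp only [Finset.mem_filter, Multiset.mem_toFinset] at hp
  exact removeBox_sum_lt hp.1 hp.2

/-- `lam` is an odd partition: all parts positive and the number of standard
Young tableaux of shape `lam` (= the character degree) is odd. -/
def OddP (lam : Multiset ℕ) : Prop :=
  (∀ x ∈ lam, 0 < x) ∧ Odd (degSYT lam)

/-- The parts of `lam` sorted in weakly decreasing order. -/
def descList (lam : Multiset ℕ) : List ℕ :=
  (lam.sort (· ≤ ·)).reverse

/-- The beta-set (set of beta-numbers) of `lam` with `m` beads:
`{ lam_i + (m - i) : 1 ≤ i ≤ m }` where `lam` is padded with zero parts. -/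
def betaSet (lam : Multiset ℕ) (m : ℕ) : Finset ℕ :=
  (Finset.range m).image (fun i => (descList lam).getD i 0 + (m - 1 - i))

/-- `mu` is obtained from `lam` by removing an `e`-hook: in some beta-set of
`lam` a beta-number `x` is replaced by `x - e` (which is not a beta-number). -/
def IsHookRemoval (e : ℕ) (lam mu : Multiset ℕ) : Prop :=
  (∀ x ∈ lam, 0 < x) ∧ (∀ x ∈ mu, 0 < x) ∧ 0 < e ∧
  ∃ m x, Multiset.card lam ≤ m ∧ Multiset.card mu ≤ m ∧
    x ∈ betaSet lam m ∧ e ≤ x ∧ x - e ∉ betaSet lam m ∧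
    betaSet mu m = insert (x - e) ((betaSet lam m).erase x)

/-- The map `f_k` : for an odd partition `lam` with `2^k ≤ |lam|`, the unique
odd partition obtained from `lam` by removing a `2^k`-hook (junk value `0` if
no such partition exists). -/
noncomputable def fkOp (k : ℕ) (lam : Multiset ℕ) : Multiset ℕ :=
  if h : ∃ mu, IsHookRemoval (2 ^ k) lam mu ∧ OddP mu then h.choose else 0

/-- The partition encoded by a finite beta-set: each bead contributes a part
equal to the number of gaps below it. -/
def partOfBeta (S : Finset ℕ) : Multiset ℕ :=
  (S.val.map (fun b => b - (S.filter (fun a => a < b)).card)).filter (fun p => 0 < p)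

/-- The 2-quotient `(lam_0, lam_1)` of `lam`, computed from a beta-set with an
even number of beads via the two runners of the 2-abacus. -/
def quot2 (lam : Multiset ℕ) : Multiset ℕ × Multiset ℕ :=
  (partOfBeta (((betaSet lam (2 * Multiset.card lam)).filter (fun b => b % 2 = 0)).image
      (fun b => b / 2)),
   partOfBeta (((betaSet lam (2 * Multiset.card lam)).filter (fun b => b % 2 = 1)).image
      (fun b => b / 2)))

/-- The `e`-core of `lam`: push all beads of an `e`-abacus configuration for
`lam` up as far as possible. -/
def coreP (e : ℕ) (lam : Multiset ℕ) : Multiset ℕ :=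
  partOfBeta ((Finset.range (e * (Multiset.card lam + e))).filter
    (fun x => x / e <
      ((betaSet lam (Multiset.card lam + e)).filter (fun b => b % e = x % e)).card))

/-- Row `k` of the 2-quotient tower of `lam`: row 0 is `[lam]`, and row `k+1`
replaces each entry of row `k` by its 2-quotient pair. -/
def towerRow : ℕ → Multiset ℕ → List (Multiset ℕ)
  | 0, lam => [lam]
  | (k + 1), lam => (towerRow k lam).flatMap (fun mu => [(quot2 mu).1, (quot2 mu).2])

/-- `R_k^j(lam)`: the component of row `k` of the 2-quotient tower of `lam`
from which a `2^(j-k)`-hook is removed in the passage from `lam` to `f_j(lam)`;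
it is characterized by: row `k` for `f_j(lam)` is obtained from row `k` for
`lam` by replacing this component by its image under `f_(j-k)`. -/
noncomputable def Rcomp (k j : ℕ) (lam : Multiset ℕ) : Multiset ℕ :=
  if h : ∃ s, s < 2 ^ k ∧
      towerRow k (fkOp j lam) =
        (towerRow k lam).set s (fkOp (j - k) ((towerRow k lam).getD s 0))
  then (towerRow k lam).getD h.choose 0 else 0


/-- The hook partition `(n - w, 1^w)`. -/
def hookPart (n w : ℕ) : Multiset ℕ := (n - w) ::ₘ Multiset.replicate w 1

/-- `G_k(n)`, the number of odd partitions `lam` of `n` with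
`f_k(f_k(lam)) = f_(k+1)(lam)`. -/
noncomputable def Gnum (k n : ℕ) : ℕ :=
  {lam : Multiset ℕ | OddP lam ∧ lam.sum = n ∧
    fkOp k (fkOp k lam) = fkOp (k + 1) lam}.ncard

/-! ### Degrees of hook partitions -/

lemma degSYT_zero : degSYT 0 = 1 := by
  rw [degSYT]; simp

lemma degSYT_of_ne_zero {lam : Multiset ℕ} (h : lam ≠ 0) :
    degSYT lam = ∑ p ∈ lam.toFinset.filter (fun p => 0 < p), degSYT (removeBox lam p) := by
  rw [degSYT, dif_neg h]
  exact Finset.sum_attach _ (fun p => degSYT (removeBox lam p))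

lemma degSYT_replicate_one (w : ℕ) : degSYT (Multiset.replicate w 1) = 1 := by
  induction w with
  | zero => simpa using degSYT_zero
  | succ w ih =>
    have h1 : (Multiset.replicate (w + 1) 1).toFinset.filter (fun p => 0 < p) = {1} := by
      ext p
      simp only [Finset.mem_filter, Multiset.mem_toFinset, Multiset.mem_replicate,
        Finset.mem_singleton]
      omega
    rw [degSYT_of_ne_zero (by simp), h1, Finset.sum_singleton, removeBox]
    simpa [Multiset.replicate_succ] using ih

lemma degSYT_cons_replicate_one (a w : ℕ) :
    degSYT ((a + 1) ::ₘ Multiset.replicate w 1) = (a + w).choose w := by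
  induction a generalizing w with
  | zero =>
    simpa [Multiset.replicate_succ] using degSYT_replicate_one (w + 1)
  | succ a iha =>
    have hbox (v : ℕ) : removeBox ((a + 1 + 1) ::ₘ Multiset.replicate v 1) (a + 1 + 1) =
        (a + 1) ::ₘ Multiset.replicate v 1 := by
      simp [removeBox]
    induction w with
    | zero =>
      have h1 : ((a + 1 + 1) ::ₘ Multiset.replicate 0 1).toFinset.filter (fun p => 0 < p)
          = {a + 1 + 1} := by
        ext p
        simp only [Finset.mem_filter, Multiset.mem_toFinset, Multiset.mem_cons,
          Multiset.mem_replicate, Finset.mem_singleton]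
        omega
      rw [degSYT_of_ne_zero (by simp), h1, Finset.sum_singleton, hbox, iha]
      simp
    | succ w ihw =>
      have h1 : ((a + 1 + 1) ::ₘ Multiset.replicate (w + 1) 1).toFinset.filter (fun p => 0 < p)
          = {a + 1 + 1, 1} := by
        ext p
        simp only [Finset.mem_filter, Multiset.mem_toFinset, Multiset.mem_cons,
          Multiset.mem_replicate, Finset.mem_singleton, Finset.mem_insert]
        omega
      have h2 : removeBox ((a + 1 + 1) ::ₘ Multiset.replicate (w + 1) 1) 1 =
          (a + 1 + 1) ::ₘ Multiset.replicate w 1 := by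
        rw [removeBox, if_pos le_rfl, Multiset.erase_cons_tail _ (by omega)]
        simp [Multiset.replicate_succ]
      rw [degSYT_of_ne_zero (by simp), h1, Finset.sum_pair (by omega), hbox, h2, iha, ihw,
        show a + 1 + (w + 1) = (a + 1 + w) + 1 by omega, Nat.choose_succ_succ,
        show a + (w + 1) = a + 1 + w by omega, add_comm]

lemma hookPart_pos {n w : ℕ} (h : w < n) : ∀ x ∈ hookPart n w, 0 < x := by
  intro x hx
  simp only [hookPart, Multiset.mem_cons, Multiset.mem_replicate] at hx
  omega

lemma hookPart_card (n w : ℕ) : Multiset.card (hookPart n w) = w + 1 := by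
  simp [hookPart]

lemma hookPart_sum {n w : ℕ} (h : w < n) : (hookPart n w).sum = n := by
  simp [hookPart]; omega

lemma hookPart_inj {n v w : ℕ} : hookPart n v = hookPart n w ↔ v = w := by
  refine ⟨fun h => ?_, fun h => h ▸ rfl⟩
  have := congrArg Multiset.card h
  simpa [hookPart_card] using this

lemma oddP_hookPart {n w : ℕ} (h : w < n) :
    OddP (hookPart n w) ↔ Odd ((n - 1).choose w) := by
  obtain ⟨a, rfl⟩ : ∃ a, n = a + 1 + w := ⟨n - 1 - w, by omega⟩
  rw [OddP, and_iff_right (hookPart_pos h), hookPart, show a + 1 + w - w = a + 1 by omega,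
    degSYT_cons_replicate_one, show a + 1 + w - 1 = a + w by omega]

/-! ### Parities of binomial coefficients -/

lemma odd_choose_iff (n k : ℕ) :
    Odd (n.choose k) ↔ (n % 2 = 1 ∨ k % 2 = 0) ∧ Odd ((n / 2).choose (k / 2)) := by
  have : Fact (Nat.Prime 2) := ⟨Nat.prime_two⟩
  have h := Choose.choose_modEq_choose_mod_mul_choose_div_nat (n := n) (k := k) (p := 2)
  have h' : Odd (n.choose k) ↔ Odd ((n % 2).choose (k % 2) * (n / 2).choose (k / 2)) := by
    rw [Nat.odd_iff, Nat.odd_iff]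
    exact iff_of_eq (congrArg (· = 1) h)
  rw [h', Nat.odd_mul]
  refine and_congr_left fun _ => ?_
  rcases Nat.mod_two_eq_zero_or_one n with hn | hn <;>
    rcases Nat.mod_two_eq_zero_or_one k with hk | hk <;> simp [hn, hk]

lemma odd_choose_two_pow_sub_one (t : ℕ) {k : ℕ} (hk : k < 2 ^ t) :
    Odd ((2 ^ t - 1).choose k) := by
  induction t generalizing k with
  | zero =>
    obtain rfl : k = 0 := by simpa using hk
    simp
  | succ t ih =>
    have h2 : 2 ^ (t + 1) = 2 * 2 ^ t := by ring
    have h0 : 0 < 2 ^ t := by positivity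
    rw [odd_choose_iff, show (2 ^ (t + 1) - 1) / 2 = 2 ^ t - 1 by omega]
    exact ⟨Or.inl (by omega), ih (by omega)⟩

lemma odd_choose_two_pow_sub_two {t k : ℕ} (ht : 1 ≤ t) (hk : k < 2 ^ t) :
    Odd ((2 ^ t - 2).choose k) ↔ k % 2 = 0 := by
  obtain ⟨t, rfl⟩ : ∃ s, t = s + 1 := ⟨t - 1, by omega⟩
  have h2 : 2 ^ (t + 1) = 2 * 2 ^ t := by ring
  have h0 : 0 < 2 ^ t := by positivity
  rw [odd_choose_iff, show (2 ^ (t + 1) - 2) / 2 = 2 ^ t - 1 by omega]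
  have := odd_choose_two_pow_sub_one t (k := k / 2) (by omega)
  simp only [this, and_true]
  omega

lemma odd_choose_two_pow_sub_three {t k : ℕ} (ht : 2 ≤ t) (hk : k < 2 ^ t) :
    Odd ((2 ^ t - 3).choose k) ↔ k % 4 < 2 := by
  obtain ⟨t, rfl⟩ : ∃ s, t = s + 1 := ⟨t - 1, by omega⟩
  have h2 : 2 ^ (t + 1) = 2 * 2 ^ t := by ring
  have h0 : 2 ^ 1 ≤ 2 ^ t := Nat.pow_le_pow_right (by omega) (by omega)
  rw [odd_choose_iff, show (2 ^ (t + 1) - 3) / 2 = 2 ^ t - 2 by omega,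
    odd_choose_two_pow_sub_two (by omega) (by omega)]
  omega

/-! ### Beta-sets -/

lemma getD_le_iff_of_pairwise {l : List ℕ} (hl : l.Pairwise (· ≥ ·)) {p : ℕ} (hp : 0 < p)
    (i : ℕ) : p ≤ l.getD i 0 ↔ i < l.countP (fun x => p ≤ x) := by
  induction l generalizing i with
  | nil => simp; omega
  | cons a l ih =>
    rw [List.pairwise_cons] at hl
    by_cases ha : p ≤ a
    · rw [List.countP_cons_of_pos (by simpa using ha)]
      cases i with
      | zero => simpa using ha
      | succ i => simpa using ih hl.2 i
    · have h0 : l.countP (fun x => p ≤ x) = 0 := by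
        rw [List.countP_eq_zero]
        intro b hb
        have := hl.1 b hb
        simp only [decide_eq_true_eq]
        omega
      rw [List.countP_cons_of_neg (by simpa using ha), h0]
      cases i with
      | zero => simpa using ha
      | succ i =>
        have := ih hl.2 i
        rw [h0] at this
        simpa using this

lemma coe_descList (lam : Multiset ℕ) : (descList lam : Multiset ℕ) = lam := by
  rw [descList, Multiset.coe_reverse, Multiset.sort_eq]

lemma length_descList (lam : Multiset ℕ) : (descList lam).length = Multiset.card lam := by
  rw [← Multiset.coe_card, coe_descList]

/-- The `i`-th largest part, counted from `0`. -/
def row (lam : Multiset ℕ) (i : ℕ) : ℕ := (descList lam).getD i 0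

/-- The `p`-th column length. -/
def col (lam : Multiset ℕ) (p : ℕ) : ℕ := lam.countP (fun x => p ≤ x)

lemma le_row_iff {lam : Multiset ℕ} {p : ℕ} (hp : 0 < p) (i : ℕ) :
    p ≤ row lam i ↔ i < col lam p := by
  have h := getD_le_iff_of_pairwise (l := descList lam)
    (by rw [descList, List.pairwise_reverse]; exact Multiset.pairwise_sort lam (· ≤ ·)) hp i
  rw [row, h, col]
  conv_rhs => rw [← coe_descList lam, Multiset.coe_countP]

lemma eq_row_iff {lam : Multiset ℕ} {f : ℕ → ℕ} :
    f = row lam ↔ ∀ p, 0 < p → ∀ i, p ≤ f i ↔ i < col lam p := by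
  refine ⟨fun h p hp i => h ▸ le_row_iff hp i, fun h => funext fun i => ?_⟩
  refine eq_of_forall_le_iff fun p => ?_
  rcases Nat.eq_zero_or_pos p with rfl | hp
  · simp
  · rw [h p hp, le_row_iff hp]

lemma row_antitone (lam : Multiset ℕ) : Antitone (row lam) := by
  intro i j hij
  rcases Nat.eq_zero_or_pos (row lam j) with h | h
  · omega
  · rw [le_row_iff h]
    exact hij.trans_lt ((le_row_iff h j).1 le_rfl)

lemma row_eq_zero {lam : Multiset ℕ} {i : ℕ} (h : Multiset.card lam ≤ i) : row lam i = 0 := by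
  rw [row, List.getD_eq_default]
  rwa [length_descList]

lemma row_mem {lam : Multiset ℕ} {i : ℕ} (h : 0 < row lam i) : row lam i ∈ lam := by
  have hi : i < (descList lam).length := by
    by_contra hi
    rw [length_descList] at hi
    rw [row_eq_zero (by omega)] at h
    omega
  rw [row, List.getD_eq_getElem _ _ hi]
  have h := List.getElem_mem hi
  rwa [← Multiset.mem_coe, coe_descList] at h

lemma map_row_range {lam : Multiset ℕ} (hpos : ∀ x ∈ lam, 0 < x) {m : ℕ}
    (hm : Multiset.card lam ≤ m) :
    ((Multiset.range m).map (row lam)).filter (fun p => 0 < p) = lam := by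
  induction m, hm using Nat.le_induction with
  | base =>
    have h1 : (List.range (Multiset.card lam)).map (row lam) = descList lam := by
      apply List.ext_getElem
      · simp [length_descList]
      · intro i h1 h2
        rw [List.getElem_map, List.getElem_range, row, List.getD_eq_getElem _ _ h2]
    rw [← Multiset.coe_range, Multiset.map_coe, h1, coe_descList, Multiset.filter_eq_self]
    exact hpos
  | succ m hm ih =>
    rw [Multiset.range_succ, Multiset.map_cons, row_eq_zero hm,
      Multiset.filter_cons_of_neg _ (lt_irrefl 0), ih]

lemma mem_betaSet {lam : Multiset ℕ} {m x : ℕ} :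
    x ∈ betaSet lam m ↔ ∃ i < m, row lam i + (m - 1 - i) = x := by
  simp [betaSet, row]

lemma beta_strictAnti {lam : Multiset ℕ} {m i j : ℕ} (hij : i < j) (hj : j < m) :
    row lam j + (m - 1 - j) < row lam i + (m - 1 - i) := by
  have := row_antitone lam hij.le
  omega

lemma beta_injOn (lam : Multiset ℕ) (m : ℕ) :
    Set.InjOn (fun i => row lam i + (m - 1 - i)) (Finset.range m : Set ℕ) := by
  intro i hi j hj h
  simp only [Finset.coe_range, Set.mem_Iio] at hi hj h
  rcases lt_trichotomy i j with hij | hij | hij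
  · have := beta_strictAnti (lam := lam) hij hj; omega
  · exact hij
  · have := beta_strictAnti (lam := lam) hij hi; omega

lemma partOfBeta_betaSet {lam : Multiset ℕ} (hpos : ∀ x ∈ lam, 0 < x) {m : ℕ}
    (hm : Multiset.card lam ≤ m) : partOfBeta (betaSet lam m) = lam := by
  have hval : (betaSet lam m).val = (Multiset.range m).map (fun i => row lam i + (m - 1 - i)) :=
    Finset.image_val_of_injOn (beta_injOn lam m)
  conv_rhs => rw [← map_row_range hpos hm]
  rw [partOfBeta, hval, Multiset.map_map]
  congr 1
  refine Multiset.map_congr rfl fun i hi => ?_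
  rw [Multiset.mem_range] at hi
  have hcard : ((betaSet lam m).filter (fun a => a < row lam i + (m - 1 - i))).card = m - 1 - i := by
    have : (betaSet lam m).filter (fun a => a < row lam i + (m - 1 - i)) =
        (Finset.Ioo i m).image (fun i => row lam i + (m - 1 - i)) := by
      ext x
      simp only [Finset.mem_filter, mem_betaSet, Finset.mem_image, Finset.mem_Ioo]
      constructor
      · rintro ⟨⟨j, hj, rfl⟩, hlt⟩
        refine ⟨j, ⟨?_, hj⟩, rfl⟩
        by_contra hji
        rcases (not_lt.1 hji).lt_or_eq with h | rfl
        · have := beta_strictAnti (lam := lam) h hi; omega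
        · omega
      · rintro ⟨j, ⟨hij, hj⟩, rfl⟩
        exact ⟨⟨j, hj, rfl⟩, beta_strictAnti hij hj⟩
    rw [this, Finset.card_image_of_injOn, Nat.card_Ioo]
    · omega
    · refine (beta_injOn lam m).mono fun j hj => ?_
      simp only [Finset.coe_Ioo, Set.mem_Ioo] at hj
      simpa using hj.2
  simp only [Function.comp_apply, hcard]
  omega

lemma betaSet_inj {lam mu : Multiset ℕ} (hl : ∀ x ∈ lam, 0 < x) (hmu : ∀ x ∈ mu, 0 < x) {m : ℕ}
    (hlm : Multiset.card lam ≤ m) (hmm : Multiset.card mu ≤ m)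
    (h : betaSet lam m = betaSet mu m) : lam = mu := by
  rw [← partOfBeta_betaSet hl hlm, h, partOfBeta_betaSet hmu hmm]

lemma betaSet_hookPart {n w m : ℕ} (hwn : w < n) (hwm : w < m) :
    betaSet (hookPart n w) m =
      insert (n + (m - 1 - w)) ((Finset.range m).erase (m - 1 - w)) := by
  have hrow : (fun i => if i = 0 then n - w else if i ≤ w then 1 else 0) =
      row (hookPart n w) := by
    rw [eq_row_iff]
    intro p hp i
    have hcol : col (hookPart n w) p = (if p = 1 then w else 0) + if p ≤ n - w then 1 else 0 := by
      rw [col, hookPart, Multiset.countP_cons, ← Multiset.coe_replicate, Multiset.coe_countP,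
        List.countP_replicate]
      congr 2
      simp only [decide_eq_true_eq, eq_iff_iff]
      omega
    rw [hcol]
    split_ifs <;> omega
  ext x
  rw [mem_betaSet, ← hrow]
  simp only [Finset.mem_insert, Finset.mem_erase, Finset.mem_range]
  constructor
  · rintro ⟨i, hi, rfl⟩
    split_ifs <;> omega
  · rintro (rfl | ⟨h1, h2⟩)
    · exact ⟨0, by omega, by simp; omega⟩
    · refine ⟨if x < m - 1 - w then m - 1 - x else m - x, ?_, ?_⟩
      · split_ifs <;> omega
      · split_ifs <;> omega

/-! ### Hooks removed from hook partitions -/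

lemma isHookRemoval_hookPart {e n w : ℕ} (he : 0 < e) (hen : e < n) (hw : w < n)
    {mu : Multiset ℕ} :
    IsHookRemoval e (hookPart n w) mu ↔
      (w + e < n ∧ mu = hookPart (n - e) w) ∨ (e ≤ w ∧ mu = hookPart (n - e) (w - e)) := by
  constructor
  · rintro ⟨-, hmu, -, m, x, hm, hmm, hx, hex, hxe, hb⟩
    rw [hookPart_card] at hm
    rw [betaSet_hookPart hw (by omega)] at hx hxe hb
    simp only [Finset.mem_insert, Finset.mem_erase, Finset.mem_range, not_or, not_and,
      ne_eq] at hx hxe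
    rcases hx with rfl | ⟨hx1, hx2⟩
    · have hwe : w + e < n := by
        by_contra h
        have := hxe.2 (by omega)
        omega
      refine Or.inl ⟨hwe, betaSet_inj hmu (hookPart_pos (by omega)) hmm
        (by rw [hookPart_card]; omega) ?_⟩
      rw [hb, betaSet_hookPart (by omega) (by omega)]
      ext z
      simp only [Finset.mem_insert, Finset.mem_erase, Finset.mem_range]
      omega
    · have hxy : x - e = m - 1 - w := by
        by_contra h
        exact hxe.2 h (by omega)
      refine Or.inr ⟨by omega, betaSet_inj hmu (hookPart_pos (by omega)) hmm
        (by rw [hookPart_card]; omega) ?_⟩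
      rw [hb, betaSet_hookPart (by omega) (by omega)]
      ext z
      simp only [Finset.mem_insert, Finset.mem_erase, Finset.mem_range]
      omega
  · rintro (⟨h, rfl⟩ | ⟨h, rfl⟩)
    · refine ⟨hookPart_pos hw, hookPart_pos (by omega), he, w + 1, n, ?_, ?_, ?_, hen.le, ?_, ?_⟩
      · rw [hookPart_card]
      · rw [hookPart_card]
      · rw [betaSet_hookPart hw (by omega)]; simp
      · rw [betaSet_hookPart hw (by omega)]; simp; omega
      · rw [betaSet_hookPart hw (by omega), betaSet_hookPart (by omega) (by omega)]
        ext z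
        simp only [Finset.mem_insert, Finset.mem_erase, Finset.mem_range]
        omega
    · refine ⟨hookPart_pos hw, hookPart_pos (by omega), he, w + 1, e, ?_, ?_, ?_, le_rfl, ?_, ?_⟩
      · rw [hookPart_card]
      · rw [hookPart_card]; omega
      · rw [betaSet_hookPart hw (by omega)]; simp; omega
      · rw [betaSet_hookPart hw (by omega)]; simp; omega
      · rw [betaSet_hookPart hw (by omega), betaSet_hookPart (by omega) (by omega)]
        ext z
        simp only [Finset.mem_insert, Finset.mem_erase, Finset.mem_range]
        omega

lemma fkOp_eq {k : ℕ} {lam mu : Multiset ℕ} (h1 : IsHookRemoval (2 ^ k) lam mu) (h2 : OddP mu)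
    (h : ∀ nu, IsHookRemoval (2 ^ k) lam nu → OddP nu → nu = mu) : fkOp k lam = mu := by
  have hex : ∃ mu, IsHookRemoval (2 ^ k) lam mu ∧ OddP mu := ⟨mu, h1, h2⟩
  rw [fkOp, dif_pos hex]
  exact h _ hex.choose_spec.1 hex.choose_spec.2

lemma fkOp_hookPart_arm {k n w : ℕ} (hw : w + 2 ^ k < n)
    (h1 : Odd ((n - 2 ^ k - 1).choose w))
    (h2 : 2 ^ k ≤ w → ¬ Odd ((n - 2 ^ k - 1).choose (w - 2 ^ k))) :
    fkOp k (hookPart n w) = hookPart (n - 2 ^ k) w := by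
  have he : 0 < 2 ^ k := by positivity
  refine fkOp_eq ((isHookRemoval_hookPart he (by omega) (by omega)).2 (Or.inl ⟨hw, rfl⟩))
    ((oddP_hookPart (by omega)).2 h1) fun nu hnu hodd => ?_
  rcases (isHookRemoval_hookPart he (by omega) (by omega)).1 hnu with h | ⟨hle, rfl⟩
  · exact h.2
  · exact absurd ((oddP_hookPart (by omega)).1 hodd) (h2 hle)

lemma fkOp_hookPart_leg {k n w : ℕ} (hen : 2 ^ k < n) (hw : w < n) (hle : 2 ^ k ≤ w)
    (h1 : Odd ((n - 2 ^ k - 1).choose (w - 2 ^ k)))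
    (h2 : w + 2 ^ k < n → ¬ Odd ((n - 2 ^ k - 1).choose w)) :
    fkOp k (hookPart n w) = hookPart (n - 2 ^ k) (w - 2 ^ k) := by
  have he : 0 < 2 ^ k := by positivity
  refine fkOp_eq ((isHookRemoval_hookPart he (by omega) (by omega)).2 (Or.inr ⟨hle, rfl⟩))
    ((oddP_hookPart (by omega)).2 h1) fun nu hnu hodd => ?_
  rcases (isHookRemoval_hookPart he (by omega) (by omega)).1 hnu with ⟨hlt, rfl⟩ | h
  · exact absurd ((oddP_hookPart (by omega)).1 hodd) (h2 hlt)
  · exact h.2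

lemma four_dvd_two_pow {t : ℕ} (ht : 2 ≤ t) : 4 ∣ 2 ^ t := pow_dvd_pow 2 ht

lemma fkOp_zero_hookPart_two_pow {t u : ℕ} (ht : 2 ≤ t) (hu : u < 2 ^ t) :
    fkOp 0 (hookPart (2 ^ t) u) = hookPart (2 ^ t - 1) (u - u % 2) := by
  have h4 := four_dvd_two_pow ht
  have hc {k : ℕ} (hk : k < 2 ^ t) := odd_choose_two_pow_sub_two (t := t) (by omega) hk
  rcases Nat.mod_two_eq_zero_or_one u with h | h <;> rw [h]
  · exact fkOp_hookPart_arm (k := 0) (by omega)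
      ((hc (by omega)).2 h) fun h1 h2 => by
        have := (hc (k := u - 1) (by omega)).1 h2
        omega
  · exact fkOp_hookPart_leg (k := 0) (by omega) hu (by omega)
      ((hc (k := u - 1) (by omega)).2 (by omega)) fun h1 h2 => by
        have := (hc (by omega)).1 h2
        omega

lemma fkOp_zero_hookPart_two_pow_sub_one {t w : ℕ} (ht : 2 ≤ t) (hw : w < 2 ^ t)
    (h2 : w % 2 = 0) :
    fkOp 0 (hookPart (2 ^ t - 1) w) = hookPart (2 ^ t - 2) (w - (w % 4) / 2) := by
  have h4 := four_dvd_two_pow ht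
  have hc {k : ℕ} (hk : k < 2 ^ t) := odd_choose_two_pow_sub_three ht hk
  obtain h | h : w % 4 = 0 ∨ w % 4 = 2 := by omega
  all_goals rw [h]
  · exact fkOp_hookPart_arm (k := 0) (by omega)
      ((hc (by omega)).2 (by omega)) fun h1 h2 => by
        have := (hc (k := w - 1) (by omega)).1 h2
        omega
  · exact fkOp_hookPart_leg (k := 0) (by omega) (by omega) (by omega)
      ((hc (k := w - 1) (by omega)).2 (by omega)) fun h1 h2 => by
        have := (hc (by omega)).1 h2
        omega

lemma fkOp_one_hookPart_two_pow {t u : ℕ} (ht : 2 ≤ t) (hu : u < 2 ^ t) :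
    fkOp 1 (hookPart (2 ^ t) u) = hookPart (2 ^ t - 2) (if u % 4 < 2 then u else u - 2) := by
  have h4 := four_dvd_two_pow ht
  have hc {k : ℕ} (hk : k < 2 ^ t) := odd_choose_two_pow_sub_three ht hk
  split_ifs with h
  · exact fkOp_hookPart_arm (k := 1) (by omega)
      ((hc (by omega)).2 h) fun h1 h2 => by
        have := (hc (k := u - 2) (by omega)).1 h2
        omega
  · exact fkOp_hookPart_leg (k := 1) (by omega) hu (by omega)
      ((hc (k := u - 2) (by omega)).2 (by omega)) fun h1 h2 => by
        have := (hc (by omega)).1 h2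
        omega

lemma fkOp_zero_zero_eq_fkOp_one_iff {t u : ℕ} (ht : 2 ≤ t) (hu : u < 2 ^ t) :
    fkOp 0 (fkOp 0 (hookPart (2 ^ t) u)) = fkOp 1 (hookPart (2 ^ t) u) ↔
      (u % 4 = 0 ∨ u % 4 = 3) := by
  rw [fkOp_zero_hookPart_two_pow ht hu,
    fkOp_zero_hookPart_two_pow_sub_one ht (by omega) (by omega),
    fkOp_one_hookPart_two_pow ht hu, hookPart_inj]
  split_ifs <;> omega

/-! ### Odd partitions of powers of two -/

/-- The beads of `S` which can be moved down by `e`. -/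
def movable (e : ℕ) (S : Finset ℕ) : Finset ℕ := S.filter (fun x => e ≤ x ∧ x - e ∉ S)

/-- The sum of `F` over all bead configurations obtained by moving a bead of `S` down by `e`. -/
def moveSum (e : ℕ) (F : Finset ℕ → ZMod 2) (S : Finset ℕ) : ZMod 2 :=
  ∑ x ∈ movable e S, F (insert (x - e) (S.erase x))

lemma mem_movable {e x : ℕ} {S : Finset ℕ} : x ∈ movable e S ↔ x ∈ S ∧ e ≤ x ∧ x - e ∉ S := by
  simp [movable]

lemma sum_sum_erase_eq_zero (A : Finset ℕ) (f : ℕ → ℕ → ZMod 2)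
    (hf : ∀ x ∈ A, ∀ y ∈ A, x ≠ y → f x y = f y x) : ∑ x ∈ A, ∑ y ∈ A.erase x, f x y = 0 := by
  rw [Finset.sum_sigma']
  refine Finset.sum_involution (fun a _ => ⟨a.2, a.1⟩) ?_ ?_ ?_ ?_
  · rintro ⟨x, y⟩ h
    simp only [Finset.mem_sigma, Finset.mem_erase] at h
    simp only
    rw [hf x h.1 y h.2.2 (Ne.symm h.2.1)]
    exact CharTwo.add_self_eq_zero _
  · rintro ⟨x, y⟩ h - heq
    simp only [Finset.mem_sigma, Finset.mem_erase] at h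
    simp only [Sigma.mk.injEq] at heq
    exact h.2.1 heq.1
  · rintro ⟨x, y⟩ h
    simp only [Finset.mem_sigma, Finset.mem_erase] at h ⊢
    exact ⟨h.2.2, Ne.symm h.2.1, h.1⟩
  · rintro ⟨x, y⟩ h
    rfl

lemma moveSum_moveSum {e : ℕ} (he : 0 < e) (F : Finset ℕ → ZMod 2) :
    moveSum e (moveSum e F) = moveSum (2 * e) F := by
  funext S
  have hmov : ∀ x ∈ movable e S, movable e (insert (x - e) (S.erase x)) =
      ((if 2 * e ≤ x ∧ x - 2 * e ∉ S then {x - e} else ∅) ∪ (if x + e ∈ S then {x + e} else ∅)) ∪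
        (movable e S).erase x := by
    intro x hx
    rw [mem_movable] at hx
    have hite (P : Prop) [Decidable P] (a y : ℕ) :
        (y ∈ if P then ({a} : Finset ℕ) else ∅) ↔ P ∧ y = a := by
      split_ifs with h <;> simp [h]
    ext y
    simp only [mem_movable, Finset.mem_union, Finset.mem_insert, Finset.mem_erase, hite]
    by_cases h1 : y = x - e
    · subst h1
      rw [show x - 2 * e = x - e - e by omega]
      grind
    · by_cases h2 : y = x + e
      · subst h2
        rw [show x + e - e = x by omega]
        grind
      · grind
  have hsum : ∀ x ∈ movable e S, moveSum e F (insert (x - e) (S.erase x)) =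
      ((if 2 * e ≤ x ∧ x - 2 * e ∉ S then F (insert (x - 2 * e) (S.erase x)) else 0) +
        (if x + e ∈ S then F (insert (x - e) (S.erase (x + e))) else 0)) +
        ∑ y ∈ (movable e S).erase x, F (insert (y - e) (insert (x - e) ((S.erase x).erase y))) := by
    intro x hx
    have hx' := mem_movable.1 hx
    rw [moveSum, hmov x hx, Finset.sum_union, Finset.sum_union]
    · congr 1
      · congr 1
        · split_ifs
          · rw [Finset.sum_singleton, Finset.erase_insert (by simp [hx'.2.2]),
              show x - e - e = x - 2 * e by omega]
          · rfl
        · split_ifs with h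
          · rw [Finset.sum_singleton, show x + e - e = x by omega]
            congr 1
            ext z
            simp only [Finset.mem_insert, Finset.mem_erase]
            grind
          · rfl
      · refine Finset.sum_congr rfl fun y hy => ?_
        rw [Finset.mem_erase, mem_movable] at hy
        rw [Finset.erase_insert_of_ne]
        rintro rfl
        exact hx'.2.2 hy.2.1
    · split_ifs <;> simp
      omega
    · rw [Finset.disjoint_left]
      intro y hy hy'
      rw [Finset.mem_erase, mem_movable] at hy'
      rw [Finset.mem_union] at hy
      rcases hy with hy | hy
      · split_ifs at hy
        · rw [Finset.mem_singleton] at hy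
          exact hx'.2.2 (hy ▸ hy'.2.1)
        · simp at hy
      · split_ifs at hy
        · rw [Finset.mem_singleton] at hy
          exact hy'.2.2.2 (by rw [hy, Nat.add_sub_cancel]; exact hx'.1)
        · simp at hy
  have hdouble : moveSum (2 * e) F S =
      ∑ x ∈ movable e S,
        (if 2 * e ≤ x ∧ x - 2 * e ∉ S then F (insert (x - 2 * e) (S.erase x)) else 0) +
      ∑ x ∈ movable e S, (if x + e ∈ S then F (insert (x - e) (S.erase (x + e))) else 0) := by
    rw [moveSum, ← Finset.sum_filter_add_sum_filter_not _ (fun x => x - e ∉ S)]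
    congr 1
    · rw [← Finset.sum_filter]
      refine Finset.sum_congr ?_ fun _ _ => rfl
      ext x
      simp only [Finset.mem_filter, mem_movable]
      constructor
      · rintro ⟨⟨h1, h2, h3⟩, h4⟩
        exact ⟨⟨h1, by omega, h4⟩, h2, h3⟩
      · rintro ⟨⟨h1, h2, h3⟩, h4, h5⟩
        exact ⟨⟨h1, h4, h5⟩, h3⟩
    · rw [← Finset.sum_filter]
      refine Finset.sum_nbij' (fun x => x - e) (fun x => x + e) ?_ ?_ ?_ ?_ ?_
      · intro x hx
        simp only [Finset.mem_filter, mem_movable, not_not] at hx ⊢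
        obtain ⟨⟨h1, h2, h3⟩, h4⟩ := hx
        rw [show x - e - e = x - 2 * e by omega, show x - e + e = x by omega]
        exact ⟨⟨h4, by omega, h3⟩, h1⟩
      · intro x hx
        simp only [Finset.mem_filter, mem_movable, not_not] at hx ⊢
        obtain ⟨⟨h1, h2, h3⟩, h4⟩ := hx
        rw [show x + e - 2 * e = x - e by omega, show x + e - e = x by omega]
        exact ⟨⟨h4, by omega, h3⟩, h1⟩
      · intro x hx
        simp only [Finset.mem_filter, mem_movable] at hx
        omega
      · intro x hx
        omega
      · intro x hx
        simp only [Finset.mem_filter, mem_movable] at hx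
        rw [show x - e - e = x - 2 * e by omega, show x - e + e = x by omega]
  rw [hdouble, moveSum, Finset.sum_congr rfl hsum, Finset.sum_add_distrib,
    Finset.sum_add_distrib, sum_sum_erase_eq_zero, add_zero]
  intro x hx y hy hxy
  rw [Finset.insert_comm, Finset.erase_right_comm]

lemma moveSum_one_iterate_two_pow (t : ℕ) (F : Finset ℕ → ZMod 2) :
    (moveSum 1)^[2 ^ t] F = moveSum (2 ^ t) F := by
  induction t generalizing F with
  | zero => rfl
  | succ t ih =>
    rw [show 2 ^ (t + 1) = 2 ^ t + 2 ^ t by ring, Function.iterate_add_apply, ih, ih,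
      moveSum_moveSum (by positivity), two_mul]

lemma col_removeBox {lam : Multiset ℕ} {p q : ℕ} (hp : p ∈ lam) (h0 : 0 < p) (hq : 0 < q) :
    col (removeBox lam p) q = col lam q - if q = p then 1 else 0 := by
  obtain ⟨mu, rfl⟩ := Multiset.exists_cons_of_mem hp
  simp only [removeBox, col, Multiset.erase_cons_head]
  split_ifs <;> simp only [Multiset.countP_cons] <;> split_ifs <;> omega

lemma col_antitone (lam : Multiset ℕ) : Antitone (col lam) := by
  intro a b hab
  rw [col, col, Multiset.countP_eq_card_filter, Multiset.countP_eq_card_filter]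
  exact Multiset.card_le_card (Multiset.monotone_filter_right _ fun c hc => hab.trans hc)

lemma col_succ_lt {lam : Multiset ℕ} {p : ℕ} (hp : p ∈ lam) : col lam (p + 1) < col lam p := by
  obtain ⟨mu, rfl⟩ := Multiset.exists_cons_of_mem hp
  have : col mu (p + 1) ≤ col mu p := col_antitone mu p.le_succ
  simp only [col, Multiset.countP_cons] at this ⊢
  split_ifs <;> omega

lemma col_le_card (lam : Multiset ℕ) (p : ℕ) : col lam p ≤ Multiset.card lam :=
  Multiset.countP_le_card _ _

lemma row_col_sub_one {lam : Multiset ℕ} {p : ℕ} (hp : p ∈ lam) (h0 : 0 < p) :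
    row lam (col lam p - 1) = p := by
  have h1 := col_succ_lt hp
  have h2 := (le_row_iff (lam := lam) h0 (col lam p - 1)).2 (by omega)
  have h3 := (le_row_iff (lam := lam) (Nat.succ_pos p) (col lam p - 1)).not.2 (by
    simp only [Nat.succ_eq_add_one]; omega)
  omega

lemma row_removeBox {lam : Multiset ℕ} {p : ℕ} (hp : p ∈ lam) (h0 : 0 < p) :
    row (removeBox lam p) = Function.update (row lam) (col lam p - 1) (p - 1) := by
  symm
  rw [eq_row_iff]
  intro q hq i
  have h1 := col_succ_lt hp
  rw [col_removeBox hp h0 hq, Function.update_apply]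
  split_ifs with hi hqp hqp
  · subst hqp; omega
  · have h2 := le_row_iff (lam := lam) hq i
    rw [hi, row_col_sub_one hp h0] at h2
    omega
  · subst hqp
    rw [le_row_iff hq]; omega
  · rw [le_row_iff hq]; omega

lemma removeBox_pos {lam : Multiset ℕ} {p : ℕ} (hpos : ∀ x ∈ lam, 0 < x) :
    ∀ x ∈ removeBox lam p, 0 < x := by
  intro x hx
  rw [removeBox] at hx
  split_ifs at hx
  · exact hpos x (Multiset.mem_of_mem_erase hx)
  · rcases Multiset.mem_cons.1 hx with rfl | hx
    · omega
    · exact hpos x (Multiset.mem_of_mem_erase hx)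

lemma card_removeBox_le {lam : Multiset ℕ} {p : ℕ} (hp : p ∈ lam) :
    Multiset.card (removeBox lam p) ≤ Multiset.card lam := by
  obtain ⟨mu, rfl⟩ := Multiset.exists_cons_of_mem hp
  rw [removeBox]
  split_ifs <;> simp

lemma removeBox_sum {lam : Multiset ℕ} {p : ℕ} (hp : p ∈ lam) (h0 : 0 < p) :
    (removeBox lam p).sum + 1 = lam.sum := by
  obtain ⟨mu, rfl⟩ := Multiset.exists_cons_of_mem hp
  rw [removeBox]
  split_ifs <;> simp <;> omega

lemma betaSet_removeBox {lam : Multiset ℕ} {m p : ℕ} (hm : Multiset.card lam ≤ m) (hp : p ∈ lam)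
    (h0 : 0 < p) :
    betaSet (removeBox lam p) m =
      insert (p + (m - col lam p) - 1) ((betaSet lam m).erase (p + (m - col lam p))) := by
  have h1 := col_succ_lt hp
  have h2 := col_le_card lam p
  have h3 := row_col_sub_one hp h0
  ext x
  simp only [Finset.mem_insert, Finset.mem_erase, mem_betaSet, row_removeBox hp h0,
    Function.update_apply]
  constructor
  · rintro ⟨i, hi, rfl⟩
    split_ifs with hic
    · omega
    · refine Or.inr ⟨fun h => hic ?_, i, hi, rfl⟩
      refine beta_injOn lam m (by simpa using hi) (by simp; omega) ?_
      simp only [h3]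
      omega
  · rintro (rfl | ⟨hne, i, hi, rfl⟩)
    · exact ⟨col lam p - 1, by omega, by rw [if_pos rfl]; omega⟩
    · refine ⟨i, hi, ?_⟩
      rw [if_neg]
      rintro rfl
      omega

lemma moveSum_one_betaSet {lam : Multiset ℕ} {m : ℕ} (hm : Multiset.card lam ≤ m)
    (F : Finset ℕ → ZMod 2) :
    moveSum 1 F (betaSet lam m) =
      ∑ p ∈ lam.toFinset.filter (fun p => 0 < p), F (betaSet (removeBox lam p) m) := by
  symm
  refine Finset.sum_bij (fun p _ => p + (m - col lam p)) ?_ ?_ ?_ ?_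
  · intro p hp
    simp only [Finset.mem_filter, Multiset.mem_toFinset] at hp
    obtain ⟨hp, h0⟩ := hp
    have h1 := col_succ_lt hp
    have h2 := col_le_card lam p
    have h3 := row_col_sub_one hp h0
    simp only [mem_movable, mem_betaSet]
    refine ⟨⟨col lam p - 1, by omega, by omega⟩, by omega, ?_⟩
    rintro ⟨j, hj, hjeq⟩
    have hlt := le_row_iff (lam := lam) h0 j
    rcases lt_or_ge j (col lam p) with h | h
    · omega
    · omega
  · intro p hp q hq h
    simp only [Finset.mem_filter, Multiset.mem_toFinset] at hp hq
    have hmono : ∀ a b, a < b → a + (m - col lam a) < b + (m - col lam b) := by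
      intro a b hab
      have := col_antitone lam hab.le
      omega
    rcases lt_trichotomy p q with hpq | hpq | hpq
    · have := hmono p q hpq; omega
    · exact hpq
    · have := hmono q p hpq; omega
  · intro x hx
    simp only [mem_movable, mem_betaSet] at hx
    obtain ⟨⟨i, hi, rfl⟩, hx1, hx2⟩ := hx
    have hpos : 0 < row lam i := by
      by_contra h
      have := row_antitone lam (Nat.le_succ i)
      exact hx2 ⟨i + 1, by omega, by simp only [Nat.succ_eq_add_one] at this; omega⟩
    have hmem := row_mem hpos
    have hic : i < col lam (row lam i) := (le_row_iff hpos i).1 le_rfl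
    have hcard := col_le_card lam (row lam i)
    have hcol : col lam (row lam i) = i + 1 := by
      by_contra h
      have h1 := (le_row_iff (lam := lam) hpos (i + 1)).2 (by omega)
      have := row_antitone lam (Nat.le_succ i)
      exact hx2 ⟨i + 1, by omega, by simp only [Nat.succ_eq_add_one] at this; omega⟩
    exact ⟨row lam i, by simp [hmem, hpos], by rw [hcol]; omega⟩
  · intro p hp
    simp only [Finset.mem_filter, Multiset.mem_toFinset] at hp
    rw [betaSet_removeBox hm hp.1 hp.2]

lemma betaSet_zero (m : ℕ) : betaSet 0 m = Finset.range m := by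
  ext x
  simp only [mem_betaSet, row_eq_zero (lam := 0) (Nat.zero_le _), Finset.mem_range]
  constructor
  · rintro ⟨i, hi, rfl⟩; omega
  · intro h; exact ⟨m - 1 - x, by omega, by omega⟩

lemma degSYT_eq_iterate_moveSum {lam : Multiset ℕ} (hpos : ∀ x ∈ lam, 0 < x) {m : ℕ}
    (hm : Multiset.card lam ≤ m) :
    (degSYT lam : ZMod 2) =
      (moveSum 1)^[lam.sum] (fun S => if S = Finset.range m then 1 else 0) (betaSet lam m) := by
  induction hn : lam.sum generalizing lam with
  | zero =>
    obtain rfl : lam = 0 := Multiset.eq_zero_of_forall_notMem fun x hx => by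
      have := hpos x hx
      have := Multiset.le_sum_of_mem hx
      omega
    simp [degSYT_zero, betaSet_zero]
  | succ n ih =>
    have h0 : lam ≠ 0 := by rintro rfl; simp at hn
    rw [Function.iterate_succ_apply', moveSum_one_betaSet hm, degSYT_of_ne_zero h0]
    push_cast
    refine Finset.sum_congr rfl fun p hp => ?_
    simp only [Finset.mem_filter, Multiset.mem_toFinset] at hp
    have := removeBox_sum hp.1 hp.2
    exact ih (removeBox_pos hpos) ((card_removeBox_le hp.1).trans hm) (by omega)

lemma exists_hookPart_of_oddP {t : ℕ} {lam : Multiset ℕ} (h : OddP lam) (hsum : lam.sum = 2 ^ t) :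
    ∃ u < 2 ^ t, lam = hookPart (2 ^ t) u := by
  obtain ⟨hpos, hodd⟩ := h
  set m := Multiset.card lam with hm
  have hdeg := degSYT_eq_iterate_moveSum hpos hm.ge
  rw [hsum, moveSum_one_iterate_two_pow, (ZMod.natCast_eq_one_iff_odd).2 hodd, moveSum] at hdeg
  obtain ⟨x, hx, hne⟩ := Finset.exists_ne_zero_of_sum_ne_zero (hdeg ▸ one_ne_zero)
  have hrange : insert (x - 2 ^ t) ((betaSet lam m).erase x) = Finset.range m := by
    by_contra h
    exact hne (if_neg h)
  obtain ⟨hxS, htx, hxt⟩ := mem_movable.1 hx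
  have h0 : 0 < 2 ^ t := by positivity
  have hmem (z : ℕ) : (z = x - 2 ^ t ∨ z ≠ x ∧ z ∈ betaSet lam m) ↔ z < m := by
    rw [← Finset.mem_range, ← hrange, Finset.mem_insert, Finset.mem_erase]
  have h1 := (hmem (x - 2 ^ t)).1 (Or.inl rfl)
  have h2 : m ≤ x := by
    by_contra h
    have := (hmem x).2 (by omega)
    omega
  refine ⟨m - 1 - (x - 2 ^ t), by omega, betaSet_inj hpos (hookPart_pos (by omega)) hm.ge
    (by rw [hookPart_card]; omega) ?_⟩
  rw [betaSet_hookPart (by omega) (by omega)]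
  ext z
  simp only [Finset.mem_insert, Finset.mem_erase, Finset.mem_range]
  rw [← hmem z, show m - 1 - (m - 1 - (x - 2 ^ t)) = x - 2 ^ t by omega,
    show 2 ^ t + (x - 2 ^ t) = x by omega]
  by_cases hzx : z = x
  · simp [hzx, hxS]
  · by_cases hz : z = x - 2 ^ t
    · subst hz
      simp only [hzx, hxt, ne_eq, not_true_eq_false, false_and, or_self]
    · simp [hzx, hz]

lemma card_filter_mod_four (n : ℕ) :
    ((Finset.range (4 * n)).filter (fun u => u % 4 = 0 ∨ u % 4 = 3)).card = 2 * n := by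
  induction n with
  | zero => rfl
  | succ n ih =>
    simp only [show 4 * (n + 1) = 4 * n + 1 + 1 + 1 + 1 by ring, Finset.range_add_one,
      Finset.filter_insert]
    rw [if_pos (by omega), if_neg (by omega), if_neg (by omega), if_pos (by omega),
      Finset.card_insert_of_notMem (by simp), Finset.card_insert_of_notMem (by simp), ih]
    ring

lemma Gnum_zero_two_pow {t : ℕ} (ht : 2 ≤ t) : Gnum 0 (2 ^ t) = 2 ^ (t - 1) := by
  have hset : {lam : Multiset ℕ | OddP lam ∧ lam.sum = 2 ^ t ∧
      fkOp 0 (fkOp 0 lam) = fkOp (0 + 1) lam} =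
      ((((Finset.range (2 ^ t)).filter (fun u => u % 4 = 0 ∨ u % 4 = 3)).image
        (hookPart (2 ^ t)) : Finset (Multiset ℕ)) : Set (Multiset ℕ)) := by
    ext lam
    simp only [Set.mem_ofPred_eq, Finset.coe_image, Set.mem_image, Finset.mem_coe,
      Finset.mem_filter, Finset.mem_range, zero_add]
    constructor
    · rintro ⟨h1, h2, h3⟩
      obtain ⟨u, hu, rfl⟩ := exists_hookPart_of_oddP h1 h2
      exact ⟨u, ⟨hu, (fkOp_zero_zero_eq_fkOp_one_iff ht hu).1 h3⟩, rfl⟩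
    · rintro ⟨u, ⟨hu, h4⟩, rfl⟩
      exact ⟨(oddP_hookPart hu).2 (odd_choose_two_pow_sub_one t hu), hookPart_sum hu,
        (fkOp_zero_zero_eq_fkOp_one_iff ht hu).2 h4⟩
  rw [Gnum, hset, Set.ncard_coe_finset,
    Finset.card_image_of_injective _ fun v w h => hookPart_inj.1 h]
  obtain ⟨s, rfl⟩ : ∃ s, t = s + 2 := ⟨t - 2, by omega⟩
  rw [show 2 ^ (s + 2) = 4 * 2 ^ s by ring, card_filter_mod_four, show s + 2 - 1 = s + 1 by omega]
  ring

theorem stmt11 (t : ℕ) (ht : 2 ≤ t) (u : ℕ) (hu : u ≤ 2 ^ t - 1) :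
    (fkOp 0 (fkOp 0 (hookPart (2 ^ t) u)) = fkOp 1 (hookPart (2 ^ t) u) ↔
      (u % 4 = 0 ∨ u % 4 = 3)) ∧
    Gnum 0 (2 ^ t) = 2 ^ (t - 1) := by
  exact ⟨fkOp_zero_zero_eq_fkOp_one_iff ht (by have := Nat.two_pow_pos t; omega),
    Gnum_zero_two_pow ht⟩

end OddSym
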